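/- arXiv:2503.20087 — 2 statements merged into one kernel-verified Lean document; each statement's English description precedes it below -/
import Mathlib

section
/- Uniform bound on VAW expert predictions (relation (3.20)): let λ > 0, Y > 0, and for j = 1,…,N let (u_{t,j})_{t=1}^T ⊂ ℝ^m be arbitrary vectors with ‖u_{t,j}‖_2² ≤ 2m, and let y_1,…,y_T ∈ ℝ with |y_t| ≤ Y. Let w_{t,j} ∈ ℝ^m be the VAW iterates with parameter λ applied to the sequence (u_{t,j}, y_t)_{t=1}^T. Then for every t ∈ {1,…,T}, Σ_{j=1}^N ⟨w_{t,j}, u_{t,j}⟩² ≤ 2(T+1) N Y² + 2 m N Y² ln(1 + 2T/λ). -/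
open MeasureTheory

/-- The Vovk–Azoury–Warmuth (VAW) iterates with regularization parameter `lam`,
applied to input vectors `u 1, u 2, …` (indexed by a finite type `ι`) and labels
`y 1, y 2, …`:  `w t = S t ⁻¹ (∑_{i=1}^{t-1} y i • u i)`, where
`S t = lam • I + ∑_{i=1}^{t} (u i) (u i)ᵀ` (positive definite, hence the matrix
inverse is the true inverse). -/
noncomputable def vaw {ι : Type*} [Fintype ι] [DecidableEq ι] (lam : ℝ)
    (u : ℕ → ι → ℝ) (y : ℕ → ℝ) (t : ℕ) : ι → ℝ :=
  ((lam • (1 : Matrix ι ι ℝ) + ∑ i ∈ Finset.Icc 1 t, Matrix.vecMulVec (u i) (u i))⁻¹).mulVec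
    (∑ i ∈ Finset.Icc 1 (t - 1), y i • u i)

open Matrix in
/-- The VAW prediction at round `t` is bounded by the labels seen so far:
`⟨w t, u t⟩² ≤ ∑_{i=1}^{t-1} (y i)²`. -/
theorem vaw_dotProduct_sq_le {ι : Type*} [Fintype ι] [DecidableEq ι] {lam : ℝ} (hlam : 0 < lam)
    (u : ℕ → ι → ℝ) (y : ℕ → ℝ) {t : ℕ} (ht : 1 ≤ t) :
    (vaw lam u y t ⬝ᵥ u t) ^ 2 ≤ ∑ i ∈ Finset.Icc 1 (t - 1), y i ^ 2 := by
  set S : Matrix ι ι ℝ :=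
    lam • (1 : Matrix ι ι ℝ) + ∑ i ∈ Finset.Icc 1 t, vecMulVec (u i) (u i) with hS
  have hpos : S.PosDef := by
    refine (PosDef.one.smul hlam).add_posSemidef (posSemidef_sum _ fun i _ => ?_)
    simpa using posSemidef_vecMulVec_self_star (u i)
  set v : ι → ℝ := S⁻¹ *ᵥ u t with hv
  have hSv : S *ᵥ v = u t := by
    rw [hv, mulVec_mulVec, mul_nonsing_inv _ ((isUnit_iff_isUnit_det S).1 hpos.isUnit), one_mulVec]
  have hsymm : S⁻¹ᵀ = S⁻¹ := by
    simpa [IsHermitian, conjTranspose_eq_transpose_of_trivial] using hpos.inv.isHermitian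
  have hpred : vaw lam u y t ⬝ᵥ u t = ∑ i ∈ Finset.Icc 1 (t - 1), y i * (u i ⬝ᵥ v) := by
    have : vaw lam u y t = (∑ i ∈ Finset.Icc 1 (t - 1), y i • u i) ᵥ* S⁻¹ := by
      rw [← hsymm, vecMul_transpose]
      rfl
    rw [this, ← dotProduct_mulVec, sum_dotProduct]
    simp [smul_dotProduct, hv]
  have hquad : v ⬝ᵥ u t = lam * (v ⬝ᵥ v) + ∑ i ∈ Finset.Icc 1 t, (u i ⬝ᵥ v) ^ 2 := by
    rw [← hSv, hS, add_mulVec, dotProduct_add, sum_mulVec, dotProduct_sum, smul_mulVec,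
      one_mulVec, dotProduct_smul, smul_eq_mul]
    congr 1
    refine Finset.sum_congr rfl fun i _ => ?_
    simp [vecMulVec_mulVec, dotProduct_comm v (u i), sq]
  have hvv : 0 ≤ lam * (v ⬝ᵥ v) :=
    mul_nonneg hlam.le (Finset.sum_nonneg fun i _ => mul_self_nonneg _)
  have hlast : (u t ⬝ᵥ v) ^ 2 ≤ ∑ i ∈ Finset.Icc 1 t, (u i ⬝ᵥ v) ^ 2 :=
    Finset.single_le_sum (f := fun i => (u i ⬝ᵥ v) ^ 2) (fun i _ => sq_nonneg _)
      (Finset.mem_Icc.2 ⟨ht, le_rfl⟩)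
  have hle : ∑ i ∈ Finset.Icc 1 (t - 1), (u i ⬝ᵥ v) ^ 2 ≤ 1 := by
    have : ∑ i ∈ Finset.Icc 1 (t - 1), (u i ⬝ᵥ v) ^ 2 ≤ ∑ i ∈ Finset.Icc 1 t, (u i ⬝ᵥ v) ^ 2 :=
      Finset.sum_le_sum_of_subset_of_nonneg (Finset.Icc_subset_Icc_right (Nat.sub_le t 1))
        fun i _ _ => sq_nonneg _
    rw [dotProduct_comm] at hquad
    nlinarith [sq_nonneg (u t ⬝ᵥ v - 1)]
  rw [hpred]
  exact (Finset.sum_mul_sq_le_sq_mul_sq _ _ _).trans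
    (mul_le_of_le_one_right (Finset.sum_nonneg fun i _ => sq_nonneg _) hle)

/-- **Uniform bound on VAW expert predictions (relation (3.20)).**
Let `λ > 0`, `Y > 0`, and for `j = 1,…,N` let `(u_{t,j})ₜ ⊂ ℝ^m` be arbitrary
vectors with `‖u_{t,j}‖₂² ≤ 2m`, and `|y_t| ≤ Y`.  If `w_{t,j}` are the VAW
iterates with parameter `λ` on `(u_{t,j}, y_t)ₜ`, then for every `t ∈ {1,…,T}`:
`∑ⱼ ⟨w_{t,j}, u_{t,j}⟩² ≤ 2(T+1) N Y² + 2 m N Y² ln(1 + 2T/λ)`. -/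
theorem vaw_expert_predictions_uniform_bound
    (N m T : ℕ) (lam Y : ℝ) (hlam : 0 < lam) (hY : 0 < Y)
    (u : Fin N → ℕ → Fin m → ℝ)
    (hu : ∀ j, ∀ t ∈ Finset.Icc 1 T, (∑ k, (u j t k) ^ 2) ≤ 2 * m)
    (y : ℕ → ℝ) (hy : ∀ t ∈ Finset.Icc 1 T, |y t| ≤ Y) :
    ∀ t ∈ Finset.Icc 1 T,
      (∑ j, (∑ k, vaw lam (u j) y t k * u j t k) ^ 2)
        ≤ 2 * (T + 1) * N * Y ^ 2 + 2 * m * N * Y ^ 2 * Real.log (1 + 2 * T / lam) := by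
  intro t ht
  obtain ⟨ht1, htT⟩ := Finset.mem_Icc.1 ht
  have hexpert : ∀ j, (∑ k, vaw lam (u j) y t k * u j t k) ^ 2 ≤ T * Y ^ 2 := fun j => by
    calc (∑ k, vaw lam (u j) y t k * u j t k) ^ 2
        ≤ ∑ i ∈ Finset.Icc 1 (t - 1), y i ^ 2 := vaw_dotProduct_sq_le hlam (u j) y ht1
      _ ≤ ∑ i ∈ Finset.Icc 1 T, y i ^ 2 :=
          Finset.sum_le_sum_of_subset_of_nonneg
            (Finset.Icc_subset_Icc_right ((Nat.sub_le t 1).trans htT)) fun i _ _ => sq_nonneg _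
      _ ≤ ∑ _i ∈ Finset.Icc 1 T, Y ^ 2 :=
          Finset.sum_le_sum fun i hi => sq_le_sq.2 ((hy i hi).trans (le_abs_self Y))
      _ = T * Y ^ 2 := by simp
  have hlog : 0 ≤ Real.log (1 + 2 * T / lam) :=
    Real.log_nonneg (le_add_of_nonneg_right (by positivity))
  calc (∑ j, (∑ k, vaw lam (u j) y t k * u j t k) ^ 2)
      ≤ ∑ _j : Fin N, (T * Y ^ 2 : ℝ) := Finset.sum_le_sum fun j _ => hexpert j
    _ = T * N * Y ^ 2 := by
        simp only [Finset.sum_const, Finset.card_univ, Fintype.card_fin, nsmul_eq_mul]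
        ring
    _ ≤ 2 * (T + 1) * N * Y ^ 2 := by
        gcongr
        linarith [Nat.cast_nonneg (α := ℝ) T]
    _ ≤ _ := le_add_of_nonneg_right (by positivity)
end

section
/- Cumulative loss bound for a single VAW expert (used in the proof of Theorem 2): let λ > 0, Y > 0, let u_1,…,u_T ∈ ℝ^m satisfy ‖u_t‖_2² ≤ 2m, and let y_1,…,y_T ∈ ℝ with |y_t| ≤ Y. Let w_t ∈ ℝ^m be the VAW iterates with parameter λ applied to (u_t, y_t)_{t=1}^T. Then (1/2) Σ_{t=1}^T (⟨w_t, u_t⟩ − y_t)² ≤ T Y²/2 + (m Y²/2) ln(1 + 2T/λ). -/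
open MeasureTheory

open Matrix in
theorem Matrix.PosDef.add_vecMulVec_self {ι : Type*} [Fintype ι]
    {A : Matrix ι ι ℝ} (hA : A.PosDef) (u : ι → ℝ) : (A + vecMulVec u u).PosDef :=
  hA.add_posSemidef (by simpa using posSemidef_vecMulVec_self_star u)

open Matrix in
/-- The matrix determinant lemma for a symmetric rank-one update, in terms of the inverse of the
updated matrix. -/
theorem Matrix.det_eq_det_add_vecMulVec_mul {ι : Type*} [Fintype ι] [DecidableEq ι]
    {A : Matrix ι ι ℝ} (u : ι → ℝ) (hS : IsUnit (A + vecMulVec u u).det) :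
    A.det = (A + vecMulVec u u).det * (1 - u ⬝ᵥ (A + vecMulVec u u)⁻¹ *ᵥ u) := by
  have h := det_add_replicateCol_mul_replicateRow (ι := Unit) hS (-u) u
  rw [← vecMulVec_eq Unit, neg_vecMulVec, add_neg_cancel_right] at h
  rw [h, det_eq_elem_of_card_eq_one Fintype.card_unit (), add_apply, one_apply_eq,
    Matrix.mul_assoc, ← replicateCol_mulVec, replicateRow_mul_replicateCol_apply, mulVec_neg,
    dotProduct_neg, ← sub_eq_add_neg]

open Matrix in
/-- The quadratic form of the inverse of the updated matrix at the new input is bounded by the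
increase of the log-determinant. -/
theorem Matrix.PosDef.dotProduct_inv_add_vecMulVec_le_log {ι : Type*} [Fintype ι] [DecidableEq ι]
    {A : Matrix ι ι ℝ} (hA : A.PosDef) (u : ι → ℝ) :
    u ⬝ᵥ (A + vecMulVec u u)⁻¹ *ᵥ u ≤
      Real.log (A + vecMulVec u u).det - Real.log A.det := by
  have hS := (hA.add_vecMulVec_self u).det_pos
  have hdet := det_eq_det_add_vecMulVec_mul u hS.ne'.isUnit
  have hpos : 0 < 1 - u ⬝ᵥ (A + vecMulVec u u)⁻¹ *ᵥ u :=
    (mul_pos_iff_of_pos_left hS).mp (hdet ▸ hA.det_pos)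
  rw [hdet, Real.log_mul hS.ne' hpos.ne']
  linarith [Real.log_le_sub_one_of_pos hpos]

open Matrix in
theorem Matrix.IsHermitian.dotProduct_mulVec_comm {ι : Type*} [Fintype ι]
    {A : Matrix ι ι ℝ} (hA : A.IsHermitian) (v w : ι → ℝ) : v ⬝ᵥ A *ᵥ w = w ⬝ᵥ A *ᵥ v := by
  have h : Aᵀ = A := by simpa [IsHermitian] using hA
  rw [dotProduct_mulVec, ← mulVec_transpose, h, dotProduct_comm]

open Matrix in
/-- A rank-one update decreases the quadratic form of the inverse by at least the square of the
prediction made with the updated matrix. -/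
theorem Matrix.PosDef.dotProduct_inv_add_vecMulVec_add_sq_le {ι : Type*} [Fintype ι]
    [DecidableEq ι] {A : Matrix ι ι ℝ} (hA : A.PosDef) (u b : ι → ℝ) :
    b ⬝ᵥ (A + vecMulVec u u)⁻¹ *ᵥ b + (u ⬝ᵥ (A + vecMulVec u u)⁻¹ *ᵥ b) ^ 2 ≤
      b ⬝ᵥ A⁻¹ *ᵥ b := by
  have hS := hA.add_vecMulVec_self u
  set w := (A + vecMulVec u u)⁻¹ *ᵥ b
  set p := u ⬝ᵥ w
  have hw : A *ᵥ w + p • u = b := by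
    have : (A + vecMulVec u u) *ᵥ w = b := by
      simp [w, mulVec_mulVec, mul_nonsing_inv _ hS.det_pos.ne'.isUnit]
    rw [← this, add_mulVec, vecMulVec_mulVec]
    simp [p]
  have hv : w + p • A⁻¹ *ᵥ u = A⁻¹ *ᵥ b := by
    rw [← hw, mulVec_add, mulVec_mulVec, nonsing_inv_mul _ hA.det_pos.ne'.isUnit, one_mulVec,
      mulVec_smul]
  have hb : b ⬝ᵥ A⁻¹ *ᵥ u = p + p * (u ⬝ᵥ A⁻¹ *ᵥ u) := by
    rw [hA.inv.1.dotProduct_mulVec_comm, ← hv]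
    simp [dotProduct_add, p]
  have hnn : 0 ≤ u ⬝ᵥ A⁻¹ *ᵥ u := by simpa using hA.inv.posSemidef.dotProduct_mulVec_nonneg u
  rw [← hv, dotProduct_add, dotProduct_smul, hb, smul_eq_mul]
  nlinarith [mul_nonneg (sq_nonneg p) hnn]

open Matrix in
/-- One-step loss bound for a forecaster predicting with the updated inverse. -/
theorem Matrix.PosDef.sq_sub_add_dotProduct_inv_le {ι : Type*} [Fintype ι] [DecidableEq ι]
    {A : Matrix ι ι ℝ} (hA : A.PosDef) (u b : ι → ℝ) (y : ℝ) :
    (u ⬝ᵥ (A + vecMulVec u u)⁻¹ *ᵥ b - y) ^ 2 +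
        (b + y • u) ⬝ᵥ (A + vecMulVec u u)⁻¹ *ᵥ (b + y • u) ≤
      y ^ 2 + y ^ 2 * (Real.log (A + vecMulVec u u).det - Real.log A.det) +
        b ⬝ᵥ A⁻¹ *ᵥ b := by
  have hquad := hA.dotProduct_inv_add_vecMulVec_add_sq_le u b
  have hlog := mul_le_mul_of_nonneg_left (hA.dotProduct_inv_add_vecMulVec_le_log u) (sq_nonneg y)
  have hcomm := (hA.add_vecMulVec_self u).inv.1.dotProduct_mulVec_comm b u
  simp only [mulVec_add, mulVec_smul, dotProduct_add, add_dotProduct, dotProduct_smul,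
    smul_dotProduct, smul_eq_mul, hcomm]
  linarith

open Matrix in
theorem Matrix.PosDef.log_det_le {ι : Type*} [Fintype ι] [DecidableEq ι]
    {A : Matrix ι ι ℝ} (hA : A.PosDef) {c : ℝ} (hc : 0 < c)
    (htr : A.trace ≤ Fintype.card ι * c) : Real.log A.det ≤ Fintype.card ι * Real.log c := by
  have htr' : A.trace = ∑ i, hA.1.eigenvalues i := by simpa using hA.1.trace_eq_sum_eigenvalues
  have hdet : A.det = ∏ i, hA.1.eigenvalues i := by simpa using hA.1.det_eq_prod_eigenvalues
  have hle (i : ι) : Real.log (hA.1.eigenvalues i) ≤ Real.log c + hA.1.eigenvalues i / c - 1 := by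
    have h := Real.log_le_sub_one_of_pos (div_pos (hA.eigenvalues_pos i) hc)
    rw [Real.log_div (hA.eigenvalues_pos i).ne' hc.ne'] at h
    linarith
  rw [hdet, Real.log_prod fun i _ => (hA.eigenvalues_pos i).ne']
  refine (Finset.sum_le_sum fun i _ => hle i).trans ?_
  have hdiv : A.trace / c ≤ Fintype.card ι := (div_le_iff₀ hc).mpr htr
  rw [Finset.sum_sub_distrib, Finset.sum_add_distrib, ← Finset.sum_div, ← htr']
  simp only [Finset.sum_const, Finset.card_univ, nsmul_eq_mul, mul_one]
  linarith

/-- The regularized Gram matrix of the first `t` inputs. -/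
noncomputable def regularizedGram {ι : Type*} [DecidableEq ι] (lam : ℝ) (u : ℕ → ι → ℝ) (t : ℕ) :
    Matrix ι ι ℝ :=
  lam • (1 : Matrix ι ι ℝ) + ∑ i ∈ Finset.Icc 1 t, Matrix.vecMulVec (u i) (u i)

theorem regularizedGram_zero {ι : Type*} [DecidableEq ι] (lam : ℝ) (u : ℕ → ι → ℝ) :
    regularizedGram lam u 0 = lam • (1 : Matrix ι ι ℝ) := by
  simp [regularizedGram]

theorem regularizedGram_succ {ι : Type*} [DecidableEq ι] (lam : ℝ) (u : ℕ → ι → ℝ) (t : ℕ) :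
    regularizedGram lam u (t + 1) =
      regularizedGram lam u t + Matrix.vecMulVec (u (t + 1)) (u (t + 1)) := by
  rw [regularizedGram, Finset.sum_Icc_succ_top (by lia), ← add_assoc, regularizedGram]

theorem regularizedGram_posDef {ι : Type*} [Fintype ι] [DecidableEq ι] {lam : ℝ} (hlam : 0 < lam)
    (u : ℕ → ι → ℝ) (t : ℕ) : (regularizedGram lam u t).PosDef := by
  induction t with
  | zero => exact regularizedGram_zero lam u ▸ Matrix.PosDef.one.smul hlam
  | succ t ih => exact regularizedGram_succ lam u t ▸ ih.add_vecMulVec_self _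

open Matrix in
/-- Cumulative loss of the VAW forecaster in terms of the log-determinant of the regularized Gram
matrix. -/
theorem sum_sq_vaw_sub_add_le {ι : Type*} [Fintype ι] [DecidableEq ι] {lam Y : ℝ}
    (hlam : 0 < lam) (u : ℕ → ι → ℝ) (y : ℕ → ℝ) (T : ℕ)
    (hy : ∀ t ∈ Finset.Icc 1 T, |y t| ≤ Y) :
    ∑ t ∈ Finset.Icc 1 T, ((∑ k, vaw lam u y t k * u t k) - y t) ^ 2 +
        (∑ i ∈ Finset.Icc 1 T, y i • u i) ⬝ᵥ
          (regularizedGram lam u T)⁻¹ *ᵥ (∑ i ∈ Finset.Icc 1 T, y i • u i) ≤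
      T * Y ^ 2 + Y ^ 2 *
        (Real.log (regularizedGram lam u T).det - Real.log (regularizedGram lam u 0).det) := by
  induction T with
  | zero => simp
  | succ T ih =>
    have hprev := ih fun t ht => hy t (Finset.Icc_subset_Icc_right T.le_succ ht)
    have hA := regularizedGram_posDef hlam u T
    have hstep := hA.sq_sub_add_dotProduct_inv_le (u (T + 1)) (∑ i ∈ Finset.Icc 1 T, y i • u i)
      (y (T + 1))
    have hlog : 0 ≤ Real.log (regularizedGram lam u (T + 1)).det -
        Real.log (regularizedGram lam u T).det := by
      rw [regularizedGram_succ]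
      refine le_trans ?_ (hA.dotProduct_inv_add_vecMulVec_le_log _)
      simpa using (hA.add_vecMulVec_self (u (T + 1))).inv.posSemidef.dotProduct_mulVec_nonneg
        (u (T + 1))
    have hpred : ∑ k, vaw lam u y (T + 1) k * u (T + 1) k =
        u (T + 1) ⬝ᵥ (regularizedGram lam u (T + 1))⁻¹ *ᵥ ∑ i ∈ Finset.Icc 1 T, y i • u i :=
      dotProduct_comm _ _
    have hyT : y (T + 1) ^ 2 ≤ Y ^ 2 :=
      sq_le_sq' (abs_le.mp (hy (T + 1) (by simp))).1 (abs_le.mp (hy (T + 1) (by simp))).2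
    rw [← regularizedGram_succ] at hstep
    rw [Finset.sum_Icc_succ_top (by lia), Finset.sum_Icc_succ_top (by lia), hpred]
    push_cast
    nlinarith [mul_le_mul_of_nonneg_right hyT hlog]

/-- **Cumulative loss bound for a single VAW expert (used in the proof of Theorem 2).**
Let `λ > 0`, `Y > 0`, `u_1,…,u_T ∈ ℝ^m` with `‖u_t‖₂² ≤ 2m`, and `|y_t| ≤ Y`.
If `w_t` are the VAW iterates with parameter `λ` on `(u_t, y_t)ₜ`, then
`(1/2) ∑ₜ (⟨w_t, u_t⟩ − y_t)² ≤ T Y²/2 + (m Y²/2) ln(1 + 2T/λ)`. -/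
theorem vaw_single_expert_cumulative_loss_bound
    (m T : ℕ) (lam Y : ℝ) (hlam : 0 < lam) (hY : 0 < Y)
    (u : ℕ → Fin m → ℝ)
    (hu : ∀ t ∈ Finset.Icc 1 T, (∑ k, (u t k) ^ 2) ≤ 2 * m)
    (y : ℕ → ℝ) (hy : ∀ t ∈ Finset.Icc 1 T, |y t| ≤ Y) :
    (1 / 2) * ∑ t ∈ Finset.Icc 1 T, ((∑ k, vaw lam u y t k * u t k) - y t) ^ 2
      ≤ T * Y ^ 2 / 2 + m * Y ^ 2 / 2 * Real.log (1 + 2 * T / lam) := by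
  have hT : (0 : ℝ) ≤ 2 * T := by positivity
  have hloss := sum_sq_vaw_sub_add_le hlam u y T hy
  have hpot := (regularizedGram_posDef hlam u T).inv.posSemidef.dotProduct_mulVec_nonneg
    (∑ i ∈ Finset.Icc 1 T, y i • u i)
  rw [star_trivial] at hpot
  have htr : (regularizedGram lam u T).trace ≤ Fintype.card (Fin m) * (lam + 2 * T) := by
    have hsum : ∑ t ∈ Finset.Icc 1 T, ∑ k, u t k ^ 2 ≤ T * (2 * m) := by
      simpa using Finset.sum_le_card_nsmul _ _ _ hu
    have : (regularizedGram lam u T).trace =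
        lam * m + ∑ t ∈ Finset.Icc 1 T, ∑ k, u t k ^ 2 := by
      simp [regularizedGram, Matrix.trace_sum, Matrix.trace_vecMulVec, dotProduct, sq]
    rw [this, Fintype.card_fin]
    linarith
  have hdet := (regularizedGram_posDef hlam u T).log_det_le (by linarith) htr
  have hdet₀ : Real.log (regularizedGram lam u 0).det = m * Real.log lam := by
    simp [regularizedGram_zero]
  have hratio : Real.log (1 + 2 * T / lam) = Real.log (lam + 2 * T) - Real.log lam := by
    rw [← Real.log_div (by linarith) hlam.ne', add_div, div_self hlam.ne']
  rw [Fintype.card_fin] at hdet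
  rw [hratio]
  rw [hdet₀] at hloss
  nlinarith [mul_le_mul_of_nonneg_left hdet (sq_nonneg Y)]
end
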